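/- Let S ⊆ ℝⁿ be a measurable set, q : S → ℝ measurable and nonnegative, and r ≥ 0. For i = 1, 2 let ρᵢ, ρ̄ᵢ : S → ℝ be measurable functions with ρᵢ(x) > 0 for almost every x ∈ S, and suppose that x ↦ q(x)ρᵢ(x) + r ρ̄ᵢ(x)²/ρᵢ(x) is Lebesgue integrable on S for i = 1, 2. Then for every λ ∈ [0, 1], writing ρ = λρ₁ + (1−λ)ρ₂ and ρ̄ = λρ̄₁ + (1−λ)ρ̄₂, the function x ↦ q(x)ρ(x) + r ρ̄(x)²/ρ(x) is integrable on S and ∫_S (q ρ + r ρ̄²/ρ) dx ≤ λ ∫_S (q ρ₁ + r ρ̄₁²/ρ₁) dx + (1−λ) ∫_S (q ρ₂ + r ρ̄₂²/ρ₂) dx. -/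

import Mathlib

open MeasureTheory

/-- Joint convexity of the perspective function `(a, b) ↦ b ^ 2 / a` on `0 < a`. -/
theorem sq_div_convex_combination_le {a₁ a₂ b₁ b₂ l : ℝ} (ha₁ : 0 < a₁) (ha₂ : 0 < a₂)
    (hl0 : 0 ≤ l) (hl1 : l ≤ 1) :
    (l * b₁ + (1 - l) * b₂) ^ 2 / (l * a₁ + (1 - l) * a₂) ≤
      l * (b₁ ^ 2 / a₁) + (1 - l) * (b₂ ^ 2 / a₂) := by
  have hm : 0 ≤ 1 - l := sub_nonneg.2 hl1
  have ha : 0 < l * a₁ + (1 - l) * a₂ := (convex_Ioi (0 : ℝ)) ha₁ ha₂ hl0 hm (by ring)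
  obtain ⟨u, rfl⟩ : ∃ u, b₁ = a₁ * u := ⟨b₁ / a₁, by field_simp⟩
  obtain ⟨v, rfl⟩ : ∃ v, b₂ = a₂ * v := ⟨b₂ / a₂, by field_simp⟩
  have hu : (a₁ * u) ^ 2 / a₁ = a₁ * u ^ 2 := by field_simp
  have hv : (a₂ * v) ^ 2 / a₂ = a₂ * v ^ 2 := by field_simp
  rw [hu, hv, div_le_iff₀ ha]
  have h : 0 ≤ l * (1 - l) * (a₁ * a₂) * (u - v) ^ 2 := by positivity
  linarith

/-- Convexity of the density-space objective functional
`J(ρ, ρ̄) = ∫_S q ρ + r ρ̄²/ρ dx` in the decision variables `(ρ, ρ̄)`. -/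
theorem objective_functional_convex (n : ℕ) (S : Set (Fin n → ℝ)) (hS : MeasurableSet S)
    (q : (Fin n → ℝ) → ℝ) (hq_meas : Measurable q) (hq_nonneg : ∀ x ∈ S, 0 ≤ q x)
    (r : ℝ) (hr : 0 ≤ r)
    (ρ₁ ρ₂ ρb₁ ρb₂ : (Fin n → ℝ) → ℝ)
    (hρ₁ : Measurable ρ₁) (hρ₂ : Measurable ρ₂)
    (hρb₁ : Measurable ρb₁) (hρb₂ : Measurable ρb₂)
    (hρ₁pos : ∀ᵐ x ∂(volume.restrict S), 0 < ρ₁ x)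
    (hρ₂pos : ∀ᵐ x ∂(volume.restrict S), 0 < ρ₂ x)
    (hint₁ : IntegrableOn (fun x => q x * ρ₁ x + r * (ρb₁ x) ^ 2 / ρ₁ x) S)
    (hint₂ : IntegrableOn (fun x => q x * ρ₂ x + r * (ρb₂ x) ^ 2 / ρ₂ x) S)
    (l : ℝ) (hl0 : 0 ≤ l) (hl1 : l ≤ 1) :
    IntegrableOn
      (fun x => q x * (l * ρ₁ x + (1 - l) * ρ₂ x) +
        r * (l * ρb₁ x + (1 - l) * ρb₂ x) ^ 2 / (l * ρ₁ x + (1 - l) * ρ₂ x)) S ∧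
    (∫ x in S, (q x * (l * ρ₁ x + (1 - l) * ρ₂ x) +
        r * (l * ρb₁ x + (1 - l) * ρb₂ x) ^ 2 / (l * ρ₁ x + (1 - l) * ρ₂ x))) ≤
      l * (∫ x in S, (q x * ρ₁ x + r * (ρb₁ x) ^ 2 / ρ₁ x)) +
        (1 - l) * (∫ x in S, (q x * ρ₂ x + r * (ρb₂ x) ^ 2 / ρ₂ x)) := by
  have hm : 0 ≤ 1 - l := sub_nonneg.2 hl1
  have hq : ∀ᵐ x ∂(volume.restrict S), 0 ≤ q x := ae_restrict_of_forall_mem hS hq_nonneg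
  have hbound := (hint₁.const_mul l).add (hint₂.const_mul (1 - l))
  have hle : ∀ᵐ x ∂(volume.restrict S),
      q x * (l * ρ₁ x + (1 - l) * ρ₂ x) +
        r * (l * ρb₁ x + (1 - l) * ρb₂ x) ^ 2 / (l * ρ₁ x + (1 - l) * ρ₂ x) ≤
      l * (q x * ρ₁ x + r * (ρb₁ x) ^ 2 / ρ₁ x) +
        (1 - l) * (q x * ρ₂ x + r * (ρb₂ x) ^ 2 / ρ₂ x) := by
    filter_upwards [hρ₁pos, hρ₂pos] with x h₁ h₂
    have h := mul_le_mul_of_nonneg_left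
      (sq_div_convex_combination_le (b₁ := ρb₁ x) (b₂ := ρb₂ x) h₁ h₂ hl0 hl1) hr
    simp only [mul_div_assoc]
    linarith
  have hint : IntegrableOn
      (fun x => q x * (l * ρ₁ x + (1 - l) * ρ₂ x) +
        r * (l * ρb₁ x + (1 - l) * ρb₂ x) ^ 2 / (l * ρ₁ x + (1 - l) * ρ₂ x)) S := by
    refine hbound.mono' (Measurable.aestronglyMeasurable (by fun_prop)) ?_
    filter_upwards [hρ₁pos, hρ₂pos, hq, hle] with x h₁ h₂ hqx hx
    rw [Real.norm_of_nonneg (by positivity)]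
    exact hx
  refine ⟨hint, (integral_mono_ae hint hbound hle).trans_eq ?_⟩
  simp only [Pi.add_apply]
  rw [integral_add (hint₁.const_mul l) (hint₂.const_mul (1 - l)), integral_const_mul,
    integral_const_mul]
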